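/- arXiv:1506.08247 — 2 statements merged into one kernel-verified Lean document; each statement's English description precedes it below -/
import Mathlib

section
/- Let {δ_k}_{k≥0} be a sequence of positive real numbers satisfying δ_{k+1} ≤ δ_k − ε₁·[1 − √(1 − ε₂ δ_k)]² for all k ≥ 0, where ε₁, ε₂ > 0 and ε₂ δ₀ ≤ 1. Set ε̄ = (1/4)·ε₁·ε₂². Then {δ_k} is strictly decreasing and δ_k ≤ 1/(1/δ₀ + ε̄·k) for all k ≥ 0. -/
theorem half_le_one_sub_sqrt_one_sub {x : ℝ} (hx : x ≤ 2) : x / 2 ≤ 1 - √(1 - x) := by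
  have h : √(1 - x) ≤ 1 - x / 2 :=
    Real.sqrt_le_iff.mpr ⟨by linarith, by nlinarith [sq_nonneg x]⟩
  linarith

theorem inv_add_le_inv_of_le_sub_mul_sq {a b c : ℝ} (ha : 0 < a) (hb : 0 < b) (hc : 0 ≤ c)
    (h : b ≤ a - c * a ^ 2) : 1 / a + c ≤ 1 / b := by
  have hba : b ≤ a := h.trans (sub_le_self a (by positivity))
  have hcab : c * (a * b) ≤ c * a ^ 2 := by
    rw [sq]
    gcongr
  rw [div_add' _ _ _ ha.ne', div_le_div_iff₀ ha hb]
  linarith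

/-- Lemma 4.5(b): a positive sequence satisfying
`δ_{k+1} ≤ δ_k − ε₁ (1 − √(1 − ε₂ δ_k))²` with `ε₂ δ₀ ≤ 1` is strictly decreasing and
satisfies `δ_k ≤ 1/(1/δ₀ + ε̄ k)` where `ε̄ = ε₁ ε₂² / 4`. -/
theorem sequence_rate_exact
    (δ : ℕ → ℝ) (ε₁ ε₂ : ℝ) (hε₁ : 0 < ε₁) (hε₂ : 0 < ε₂)
    (hδpos : ∀ k : ℕ, 0 < δ k) (hδ0 : ε₂ * δ 0 ≤ 1)
    (hrec : ∀ k : ℕ, δ (k + 1) ≤ δ k - ε₁ * (1 - Real.sqrt (1 - ε₂ * δ k)) ^ 2) :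
    StrictAnti δ ∧
      ∀ k : ℕ, δ k ≤ 1 / (1 / δ 0 + (1 / 4 * ε₁ * ε₂ ^ 2) * (k : ℝ)) := by
  have hanti : StrictAnti δ := by
    refine strictAnti_nat_of_succ_lt fun k => (hrec k).trans_lt (sub_lt_self _ ?_)
    have hsqrt : √(1 - ε₂ * δ k) < 1 := by
      rw [Real.sqrt_lt' one_pos]
      linarith [mul_pos hε₂ (hδpos k)]
    have : 0 < 1 - √(1 - ε₂ * δ k) := sub_pos.mpr hsqrt
    positivity
  have hquad (k : ℕ) : δ (k + 1) ≤ δ k - (1 / 4 * ε₁ * ε₂ ^ 2) * δ k ^ 2 := by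
    have hle : ε₂ * δ k ≤ 1 :=
      (mul_le_mul_of_nonneg_left (hanti.antitone k.zero_le) hε₂.le).trans hδ0
    have hpos : 0 ≤ ε₂ * δ k / 2 := by
      have := hδpos k
      positivity
    have hsq := mul_le_mul_of_nonneg_left
      (pow_le_pow_left₀ hpos (half_le_one_sub_sqrt_one_sub (by linarith)) 2) hε₁.le
    linarith [hrec k]
  have hinv (k : ℕ) : 1 / δ 0 + (1 / 4 * ε₁ * ε₂ ^ 2) * (k : ℝ) ≤ 1 / δ k := by
    induction k with
    | zero => simp
    | succ k ih =>
      have := inv_add_le_inv_of_le_sub_mul_sq (hδpos k) (hδpos (k + 1)) (by positivity) (hquad k)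
      push_cast
      linarith
  refine ⟨hanti, fun k => ?_⟩
  have := hδpos 0
  exact (le_one_div (by positivity) (hδpos k)).mp (hinv k)
end

section
/- Let f : ℝ^n → ℝ be differentiable and strongly convex with parameter μ > 0, let C ⊆ ℝ^n be a nonempty closed convex set, let x* be the minimizer of f over C, and suppose f′(x*) ≠ 0. Let κ > 0, let m ≥ 1, and let {x_k}_{k≥0} be a sequence together with, for each k, intermediate points x_k^0 = x_k, x_k^1, ..., x_k^m = x_{k+1} such that: (i) f(x_k) < f(x*) and ⟨f′(x_k), x* − x_k⟩ ≥ 0 for all k; (ii) ⟨f′(x_k^{j−1}), x_k^j − x_k^{j−1}⟩ ≥ 0 for all k and all j ∈ {1, ..., m}; and (iii) for each k there exists j̄ ∈ {1, ..., m} with ‖x_k^{j̄} − x_k^{j̄−1}‖ + ‖x_k^{j̄−1} − x_k^0‖ ≥ (1/κ)·d(x_k, C). Then, with ε̄ = μ/(2κ²‖f′(x*)‖²), one has f(x*) − f(x_k) ≤ 1/( 1/(f(x*) − f(x₀)) + (ε̄/m)·k ) for all k ≥ 0, and ‖x* − x_k‖ ≤ √((2/μ)·(f(x*) − f(x_k))).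 -/
open Metric
open scoped RealInnerProductSpace

section InnerProduct

variable {E : Type*} [NormedAddCommGroup E] [InnerProductSpace ℝ E]

/-- First-order optimality condition for a minimizer over a convex set. -/
lemma HasGradientAt.inner_nonneg_of_isMinOn [CompleteSpace E] {f : E → ℝ} {C : Set E}
    {g a y : E} (hf : HasGradientAt f g a) (hC : Convex ℝ C) (ha : a ∈ C)
    (hmin : IsMinOn f C a) (hy : y ∈ C) : 0 ≤ ⟪g, y - a⟫ := by
  have h := hmin.localize.hasFDerivWithinAt_nonneg hf.hasFDerivAt.hasFDerivWithinAt
    (sub_mem_posTangentConeAt_of_segment_subset (hC.segment_subset ha hy))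
  simpa using h

/-- A linear functional nonnegative on `C - a` is controlled by the distance to `C`. -/
lemma inner_sub_le_norm_mul_infDist {C : Set E} {g a z : E} (hC : C.Nonempty)
    (h : ∀ y ∈ C, 0 ≤ ⟪g, y - a⟫) : ⟪g, a - z⟫ ≤ ‖g‖ * infDist z C := by
  rcases (norm_nonneg g).eq_or_lt with hg | hg
  · simp [norm_eq_zero.mp hg.symm]
  rw [← div_le_iff₀' hg, le_infDist hC]
  intro y hy
  rw [div_le_iff₀' hg]
  calc ⟪g, a - z⟫ ≤ ⟪g, a - z⟫ + ⟪g, y - a⟫ := le_add_of_nonneg_right (h y hy)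
    _ = ⟪g, y - z⟫ := by rw [← inner_add_right]; congr 1; abel
    _ ≤ ‖g‖ * ‖y - z‖ := real_inner_le_norm g _
    _ = ‖g‖ * dist z y := by rw [dist_comm, dist_eq_norm]

end InnerProduct

section Normed

variable {E : Type*} [NormedAddCommGroup E]

/-- A sequence of steps with quadratic increase of `f` increases `f` by at least the squared
length of the path divided by the number of steps. -/
lemma mul_sq_sum_norm_le_of_quadratic_increase {f : E → ℝ} {c : ℝ} (hc : 0 ≤ c) (u : ℕ → E)
    (m : ℕ) (h : ∀ j < m, c * ‖u (j + 1) - u j‖ ^ 2 ≤ f (u (j + 1)) - f (u j)) :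
    c * (∑ j ∈ Finset.range m, ‖u (j + 1) - u j‖) ^ 2 ≤ m * (f (u m) - f (u 0)) := by
  have hsum : c * ∑ j ∈ Finset.range m, ‖u (j + 1) - u j‖ ^ 2 ≤ f (u m) - f (u 0) := by
    rw [← Finset.sum_range_sub (fun j => f (u j)), Finset.mul_sum]
    exact Finset.sum_le_sum fun j hj => h j (Finset.mem_range.mp hj)
  have hcs := sq_sum_le_card_mul_sum_sq (s := Finset.range m) (f := fun j => ‖u (j + 1) - u j‖)
  rw [Finset.card_range] at hcs
  calc _ ≤ c * (m * ∑ j ∈ Finset.range m, ‖u (j + 1) - u j‖ ^ 2) := by gcongr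
    _ = m * (c * ∑ j ∈ Finset.range m, ‖u (j + 1) - u j‖ ^ 2) := by ring
    _ ≤ _ := by gcongr

lemma norm_sub_add_norm_sub_le_sum_norm (u : ℕ → E) {j m : ℕ} (hj : j < m) :
    ‖u (j + 1) - u j‖ + ‖u j - u 0‖ ≤ ∑ i ∈ Finset.range m, ‖u (i + 1) - u i‖ := by
  calc _ ≤ ‖u (j + 1) - u j‖ + ∑ i ∈ Finset.range j, ‖u (i + 1) - u i‖ := by
        gcongr
        rw [← Finset.sum_range_sub]
        exact norm_sum_le _ _
    _ = ∑ i ∈ Finset.range (j + 1), ‖u (i + 1) - u i‖ := by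
        rw [Finset.sum_range_succ, add_comm]
    _ ≤ _ := Finset.sum_le_sum_of_subset_of_nonneg
        (Finset.range_mono hj) fun _ _ _ => norm_nonneg _

end Normed

/-- A positive sequence with `e * a k ^ 2 ≤ a k - a (k + 1)` decays at rate `O(1 / k)`. -/
lemma le_one_div_of_mul_sq_le_sub {a : ℕ → ℝ} {e : ℝ} (he : 0 ≤ e) (ha : ∀ k, 0 < a k)
    (h : ∀ k, e * a k ^ 2 ≤ a k - a (k + 1)) (k : ℕ) :
    a k ≤ 1 / (1 / a 0 + e * k) := by
  have hinv : 1 / a 0 + e * k ≤ 1 / a k := by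
    induction k with
    | zero => simp
    | succ k ih =>
      have hk := ha k
      have hk1 := ha (k + 1)
      have hle : a (k + 1) ≤ a k := by nlinarith [h k, mul_nonneg he (sq_nonneg (a k))]
      have hprod : e * (a k * a (k + 1)) ≤ a k - a (k + 1) := by
        refine le_trans ?_ (h k)
        rw [sq]
        gcongr
      have hstep : e ≤ 1 / a (k + 1) - 1 / a k := by
        rw [div_sub_div _ _ hk1.ne' hk.ne', le_div_iff₀ (by positivity)]
        linarith
      push_cast
      linarith
  have h0 := ha 0
  rwa [le_one_div (ha k) (by positivity)]

/-- Theorem 4.9(b) (abstract alternative generalized Haugazeau algorithm): with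
intermediate points `x_k = x_k^0, x_k^1, …, x_k^m = x_{k+1}` satisfying
(i) `f(x_k) < f(x*)` and `⟪f′(x_k), x* − x_k⟫ ≥ 0`,
(ii) `⟪f′(x_k^{j−1}), x_k^j − x_k^{j−1}⟫ ≥ 0` for `j = 1, …, m`,
(iii) for each `k` some `j̄ ∈ {1, …, m}` has
`‖x_k^{j̄} − x_k^{j̄−1}‖ + ‖x_k^{j̄−1} − x_k^0‖ ≥ (1/κ) d(x_k, C)`,
then with `ε̄ = μ/(2κ²‖f′(x*)‖²)` one has
`f(x*) − f(x_k) ≤ 1/(1/(f(x*) − f(x₀)) + (ε̄/m) k)` and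
`‖x* − x_k‖ ≤ √((2/μ)(f(x*) − f(x_k)))`. -/
theorem alternative_generalized_haugazeau_rate {n : ℕ}
    (f : EuclideanSpace ℝ (Fin n) → ℝ)
    (f' : EuclideanSpace ℝ (Fin n) → EuclideanSpace ℝ (Fin n))
    (μ : ℝ) (hμ : 0 < μ)
    (hgrad : ∀ x, HasGradientAt f (f' x) x)
    (hsc : ∀ x y : EuclideanSpace ℝ (Fin n),
      f y ≥ f x + ⟪f' x, y - x⟫ + μ / 2 * ‖x - y‖ ^ 2)
    (C : Set (EuclideanSpace ℝ (Fin n))) (hCne : C.Nonempty)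
    (hCclosed : IsClosed C) (hCconv : Convex ℝ C)
    (xstar : EuclideanSpace ℝ (Fin n)) (hxstarC : xstar ∈ C)
    (hopt : ∀ y ∈ C, f xstar ≤ f y) (hne : f' xstar ≠ 0)
    (κ : ℝ) (hκ : 0 < κ) (m : ℕ) (hm : 1 ≤ m)
    (x : ℕ → EuclideanSpace ℝ (Fin n))
    (xi : ℕ → ℕ → EuclideanSpace ℝ (Fin n))
    (hxi0 : ∀ k : ℕ, xi k 0 = x k)
    (hxim : ∀ k : ℕ, xi k m = x (k + 1))
    (h1 : ∀ k : ℕ, f (x k) < f xstar)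
    (h1' : ∀ k : ℕ, 0 ≤ ⟪f' (x k), xstar - x k⟫)
    (h2 : ∀ k : ℕ, ∀ j : ℕ, 1 ≤ j → j ≤ m →
      0 ≤ ⟪f' (xi k (j - 1)), xi k j - xi k (j - 1)⟫)
    (h3 : ∀ k : ℕ, ∃ j : ℕ, 1 ≤ j ∧ j ≤ m ∧
      1 / κ * infDist (x k) C ≤ ‖xi k j - xi k (j - 1)‖ + ‖xi k (j - 1) - xi k 0‖) :
    ∀ k : ℕ,
      f xstar - f (x k) ≤
        1 / (1 / (f xstar - f (x 0)) +
          μ / (2 * κ ^ 2 * ‖f' xstar‖ ^ 2) / (m : ℝ) * (k : ℝ)) ∧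
      ‖xstar - x k‖ ≤ Real.sqrt (2 / μ * (f xstar - f (x k))) := by
  have hg : 0 < ‖f' xstar‖ := norm_pos_iff.mpr hne
  have hm0 : (0 : ℝ) < m := by exact_mod_cast hm
  have herr (k : ℕ) : f xstar - f (x k) ≤ ‖f' xstar‖ * infDist (x k) C := by
    refine le_trans ?_ (inner_sub_le_norm_mul_infDist hCne fun y hy =>
      (hgrad xstar).inner_nonneg_of_isMinOn hCconv hxstarC hopt hy)
    have h := hsc xstar (x k)
    have hq : 0 ≤ μ / 2 * ‖xstar - x k‖ ^ 2 := by positivity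
    rw [← neg_sub xstar (x k), inner_neg_right] at h
    linarith
  have hpath (k : ℕ) : infDist (x k) C / κ ≤
      ∑ j ∈ Finset.range m, ‖xi k (j + 1) - xi k j‖ := by
    obtain ⟨j, hj1, hjm, hj⟩ := h3 k
    obtain ⟨i, rfl⟩ := Nat.exists_eq_add_of_le' hj1
    rw [one_div_mul_eq_div] at hj
    exact hj.trans (norm_sub_add_norm_sub_le_sum_norm (xi k) hjm)
  have hinc (k : ℕ) : μ / 2 * (∑ j ∈ Finset.range m, ‖xi k (j + 1) - xi k j‖) ^ 2 ≤
      m * (f (x (k + 1)) - f (x k)) := by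
    rw [← hxim, ← hxi0]
    refine mul_sq_sum_norm_le_of_quadratic_increase (by positivity) (xi k) m fun j hj => ?_
    have h := hsc (xi k j) (xi k (j + 1))
    have hnonneg := h2 k (j + 1) (Nat.le_add_left 1 j) hj
    rw [Nat.add_sub_cancel] at hnonneg
    rw [norm_sub_rev]
    linarith
  have hdec (k : ℕ) : μ / (2 * κ ^ 2 * ‖f' xstar‖ ^ 2) / m * (f xstar - f (x k)) ^ 2 ≤
      (f xstar - f (x k)) - (f xstar - f (x (k + 1))) := by
    have hpos : 0 ≤ f xstar - f (x k) := (sub_pos.mpr (h1 k)).le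
    have hd : 0 ≤ infDist (x k) C := infDist_nonneg
    calc _ ≤ μ / (2 * κ ^ 2 * ‖f' xstar‖ ^ 2) / m * (‖f' xstar‖ * infDist (x k) C) ^ 2 := by
          gcongr
          exact herr k
      _ = μ / 2 * (infDist (x k) C / κ) ^ 2 / m := by field_simp
      _ ≤ μ / 2 * (∑ j ∈ Finset.range m, ‖xi k (j + 1) - xi k j‖) ^ 2 / m := by
          gcongr
          exact hpath k
      _ ≤ f (x (k + 1)) - f (x k) := by
          rw [div_le_iff₀' hm0]
          exact hinc k
      _ = _ := by ring
  intro k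
  refine ⟨le_one_div_of_mul_sq_le_sub (a := fun k => f xstar - f (x k)) (by positivity)
    (fun k => sub_pos.mpr (h1 k)) hdec k, Real.le_sqrt_of_sq_le ?_⟩
  have h := hsc (x k) xstar
  have hk := h1' k
  rw [div_mul_eq_mul_div, le_div_iff₀ hμ, norm_sub_rev]
  linarith
end
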